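/- There is no nontrivial strongly regular Neumaier circulant graph: there is no n, no inverse-closed subset S of ℤ/nℤ not containing 0, and no parameters (n,k,λ,μ;a,c) with 0 < μ < k such that the Cayley graph Cay(ℤ/nℤ, S) is both a strongly regular graph with parameters (n,k,λ,μ) and a Neumaier graph with parameters (n,k,λ;a,c). -/

import Mathlib

open Finset SimpleGraph Matrix

/-- A finset `C` is a regular clique with nexus `a` in `G`: it is a clique and every
vertex outside `C` has exactly `a` neighbors in `C`. -/
def SimpleGraph.IsRegularCliqueWithNexus {V : Type*} [Fintype V] [DecidableEq V]
    (G : SimpleGraph V) [DecidableRel G.Adj] (C : Finset V) (a : ℕ) : Prop :=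
  G.IsClique (C : Set V) ∧ ∀ v ∉ C, (C.filter fun u => G.Adj v u).card = a

/-- `G` is edge-regular with parameters `(n, k, l)`: it has `n` vertices, is `k`-regular,
and any two adjacent vertices have exactly `l` common neighbors. -/
def SimpleGraph.IsEdgeRegular {V : Type*} [Fintype V] [DecidableEq V]
    (G : SimpleGraph V) [DecidableRel G.Adj] (n k l : ℕ) : Prop :=
  Fintype.card V = n ∧ G.IsRegularOfDegree k ∧
    ∀ u v : V, G.Adj u v → Fintype.card (G.commonNeighbors u v) = l

/-- `G` is a Neumaier graph with parameters `(n, k, l; a, c)`: a connected, non-complete,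
edge-regular graph with parameters `(n, k, l)` containing a regular clique of size `c`
with nexus `a ≥ 1`. -/
def SimpleGraph.IsNeumaier {V : Type*} [Fintype V] [DecidableEq V]
    (G : SimpleGraph V) [DecidableRel G.Adj] (n k l a c : ℕ) : Prop :=
  G.Connected ∧ G ≠ ⊤ ∧ G.IsEdgeRegular n k l ∧ 1 ≤ a ∧
    ∃ C : Finset V, C.card = c ∧ G.IsRegularCliqueWithNexus C a

namespace AddMonoidAlgebra

variable {G : Type*}

/-- The element `∑ s ∈ S, [s]` of the group algebra. -/
noncomputable def finsetSum (R : Type*) [CommRing R] (S : Finset G) : AddMonoidAlgebra R G :=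
  ∑ s ∈ S, single s 1

variable {R : Type*} [CommRing R]

lemma coeff_sum_single_one [DecidableEq G] (S : Finset G) (f : G → G) (x : G) :
    (∑ s ∈ S, single (f s) (1 : R)).coeff x = (#{s ∈ S | f s = x} : R) := by
  rw [coeff_sum, Finsupp.finsetSum_apply, Finset.card_filter, Nat.cast_sum]
  exact Finset.sum_congr rfl fun s _ => by simp [Finsupp.single_apply]

lemma coeff_finsetSum [DecidableEq G] (S : Finset G) (x : G) :
    (finsetSum R S).coeff x = if x ∈ S then 1 else 0 := by
  have := coeff_sum_single_one (R := R) S id x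
  simp only [id] at this
  rw [finsetSum, this, Finset.filter_eq']
  split_ifs <;> simp

variable [AddCommGroup G]

lemma finsetSum_mul_finsetSum (S T : Finset G) :
    finsetSum R S * finsetSum R T = ∑ x ∈ S ×ˢ T, single (x.1 + x.2) 1 := by
  simp [finsetSum, Finset.sum_mul_sum, Finset.sum_product, single_mul_single]

lemma finsetSum_mul_univ [Fintype G] (S : Finset G) :
    finsetSum R S * finsetSum R univ = (#S : R) • finsetSum R univ := by
  have h (s : G) : single s (1 : R) * finsetSum R univ = finsetSum R univ := by
    simp only [finsetSum, Finset.mul_sum, single_mul_single, one_mul]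
    exact Fintype.sum_equiv (Equiv.addLeft s) _ _ fun _ => rfl
  conv_lhs => rw [finsetSum, Finset.sum_mul]
  simp [h, Nat.cast_smul_eq_nsmul]

lemma finsetSum_pow_char {p : ℕ} [Fact p.Prime] (S : Finset G) :
    finsetSum (ZMod p) S ^ p = ∑ s ∈ S, single (p • s) 1 := by
  have : CharP (AddMonoidAlgebra (ZMod p) G) p :=
    charP_of_injective_algebraMap (algebraMap (ZMod p) _).injective p
  simp [finsetSum, sum_pow_char, single_pow]

end AddMonoidAlgebra

open AddMonoidAlgebra

/-- A connection set of a strongly regular Cayley graph over a commutative group. -/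
structure IsRegularPartialDifferenceSet {G : Type*} [AddCommGroup G] [DecidableEq G]
    (S : Finset G) (k l μ : ℕ) : Prop where
  card_eq : #S = k
  neg_mem : ∀ s ∈ S, -s ∈ S
  zero_notMem : (0 : G) ∉ S
  card_of_mem : ∀ x ∈ S, #{y ∈ S | x - y ∈ S} = l
  card_of_notMem : ∀ x ∉ S, x ≠ 0 → #{y ∈ S | x - y ∈ S} = μ

namespace IsRegularPartialDifferenceSet

variable {G : Type*} [AddCommGroup G] [DecidableEq G] {S : Finset G} {k l μ : ℕ}

lemma sub_mem_comm (h : IsRegularPartialDifferenceSet S k l μ) {x y : G} :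
    x - y ∈ S ↔ y - x ∈ S :=
  ⟨fun hx => by simpa using h.neg_mem _ hx, fun hx => by simpa using h.neg_mem _ hx⟩

lemma sq_eq [Fintype G] (h : IsRegularPartialDifferenceSet S k l μ)
    (R : Type*) [CommRing R] :
    finsetSum R S ^ 2 = ((k : R) - μ) • (1 : AddMonoidAlgebra R G) + ((l : R) - μ) • finsetSum R S +
      (μ : R) • finsetSum R univ := by
  rw [sq, finsetSum_mul_finsetSum]
  ext x
  have key : (∑ z ∈ S ×ˢ S, single (z.1 + z.2) (1 : R)).coeff x =
      (#{y ∈ S | x - y ∈ S} : R) := by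
    rw [coeff_sum, Finsupp.finsetSum_apply, Finset.sum_product, Finset.card_filter, Nat.cast_sum]
    refine Finset.sum_congr rfl fun y _ => ?_
    simp only [coeff_single, Finsupp.single_apply, ← eq_sub_iff_add_eq']
    simp
  rw [key]
  simp only [coeff_add, coeff_smul, Finsupp.add_apply, Finsupp.smul_apply, coeff_finsetSum,
    one_def, coeff_single, Finsupp.single_apply, smul_eq_mul, Finset.mem_univ, if_true]
  by_cases hx : x ∈ S
  · have : (0 : G) ≠ x := fun h0 => h.zero_notMem (h0 ▸ hx)
    simp [h.card_of_mem x hx, hx, this]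
  · by_cases h0 : x = 0
    · subst h0
      have : S.filter (fun y => 0 - y ∈ S) = S :=
        Finset.filter_true_of_mem fun y hy => by simpa using h.neg_mem y hy
      rw [this]
      simp [hx, h.card_eq]
    · simp [h.card_of_notMem x hx h0, hx, Ne.symm h0]

/-- Modulo large primes `q`, the group algebra element of a partial difference set with integral
eigenvalues is fixed by Frobenius, so `q` is a multiplier. -/
lemma nsmul_mem_of_prime [Fintype G] (h : IsRegularPartialDifferenceSet S k l μ)
    (hμ : 0 < μ) (hμk : μ < k) {r : ℤ} (hr : r ^ 2 = ((l : ℤ) - μ) * r + (k - μ))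
    {q : ℕ} (hq : q.Prime) (hqk : 2 * k < q) (hqG : (Nat.card G).Coprime q) {x : G} (hx : x ∈ S) :
    q • x ∈ S := by
  have : Fact q.Prime := ⟨hq⟩
  set s : ℤ := (l : ℤ) - μ - r with hs
  have hrs : r * s = μ - k := by rw [hs]; linarith [hr]
  have habs : |r| * |s| = k - μ := by
    rw [← abs_mul, hrs, abs_of_neg (by omega)]; ring
  have hr1 : 1 ≤ |r| := Int.one_le_abs fun h0 => by simp [h0] at hrs; omega
  have hs1 : 1 ≤ |s| := Int.one_le_abs fun h0 => by simp [h0] at hrs; omega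
  have hrk : |r| < k := by nlinarith
  have hsk : |s| < k := by nlinarith
  have hne : r ≠ s := fun h0 => by rw [← h0] at hrs; nlinarith [mul_self_nonneg r]
  rw [abs_lt] at hrk hsk
  have hunit (a b : ℤ) (hab : a ≠ b) (ha : |a - b| < q) :
      IsUnit ((a : ZMod q) - (b : ZMod q)) := by
    rw [isUnit_iff_ne_zero, ← Int.cast_sub, Ne, ZMod.intCast_zmod_eq_zero_iff_dvd]
    intro hd
    exact sub_ne_zero.2 hab (Int.eq_zero_of_abs_lt_dvd hd ha)
  have hroot (a : ZMod q) : (Polynomial.X - Polynomial.C a) ∣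
      (Polynomial.X ^ q - Polynomial.X : Polynomial (ZMod q)) := by
    simp [Polynomial.dvd_iff_isRoot, ZMod.pow_card]
  have hdvd : (Polynomial.X - Polynomial.C ((k : ℤ) : ZMod q)) *
      ((Polynomial.X - Polynomial.C (r : ZMod q)) * (Polynomial.X - Polynomial.C (s : ZMod q))) ∣
      (Polynomial.X ^ q - Polynomial.X : Polynomial (ZMod q)) := by
    refine IsCoprime.mul_dvd (IsCoprime.mul_right ?_ ?_) (hroot _)
      (IsCoprime.mul_dvd ?_ (hroot _) (hroot _)) <;>
    refine Polynomial.isCoprime_X_sub_C_of_isUnit_sub (hunit _ _ (by omega) ?_) <;>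
    rw [abs_lt] <;> constructor <;> linarith
  set σ := finsetSum (ZMod q) S with hσ
  set J := finsetSum (ZMod q) (univ : Finset G) with hJ
  have hσJ : σ * J = (k : ZMod q) • J := by rw [hσ, finsetSum_mul_univ, h.card_eq]
  have hfrob : σ ^ q = σ := by
    obtain ⟨f, hf⟩ := hdvd
    have := congrArg (Polynomial.aeval σ) hf
    have hrs' : (r : ZMod q) * s = μ - k := by exact_mod_cast congrArg (Int.cast (R := ZMod q)) hrs
    have hrs'' : (r : ZMod q) + s = l - μ := by rw [hs]; push_cast; ring
    have hquad : (σ - algebraMap (ZMod q) _ r) * (σ - algebraMap (ZMod q) _ s) =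
        (μ : ZMod q) • J := by
      calc _ = σ ^ 2 - algebraMap (ZMod q) _ (r + s) * σ + algebraMap (ZMod q) _ (r * s) := by
            rw [map_add, map_mul]; ring
        _ = _ := by
            rw [hσ, h.sq_eq, hrs', hrs'']
            simp only [Algebra.smul_def, map_sub, hJ]
            ring
    have hcub : (σ - algebraMap (ZMod q) _ ((k : ℤ) : ZMod q)) *
        ((σ - algebraMap (ZMod q) _ r) * (σ - algebraMap (ZMod q) _ s)) = 0 := by
      rw [hquad, mul_smul_comm, sub_mul, hσJ, ← Algebra.smul_def]
      simp
    simp only [map_sub, map_pow, map_mul, Polynomial.aeval_X, Polynomial.aeval_C] at this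
    rw [hcub, zero_mul, sub_eq_zero] at this
    exact this
  have hcoeff := congrArg (fun z => z.coeff (q • x)) hfrob
  simp only [hσ, finsetSum_pow_char, coeff_sum_single_one, coeff_finsetSum] at hcoeff
  have hinj : Function.Injective fun y : G => q • y := (nsmulCoprime hqG).injective
  have hfil : S.filter (fun y => q • y = q • x) = {x} := by
    ext y
    simp only [Finset.mem_filter, Finset.mem_singleton]
    exact ⟨fun hy => hinj hy.2, fun hy => by simp [hy, hx]⟩
  rw [hfil] at hcoeff
  by_contra hn
  simp [hn] at hcoeff

lemma exists_pow_eq [Fintype G] (h : IsRegularPartialDifferenceSet S k l μ)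
    (R : Type*) [CommRing R] (m : ℕ) : ∃ α β γ : R,
    finsetSum R S ^ m = α • (1 : AddMonoidAlgebra R G) + β • finsetSum R S +
      γ • finsetSum R univ := by
  induction m with
  | zero => exact ⟨1, 0, 0, by simp⟩
  | succ m ih =>
    obtain ⟨α, β, γ, ih⟩ := ih
    refine ⟨β * (k - μ), α + β * (l - μ), β * μ + γ * k, ?_⟩
    have hJ := finsetSum_mul_univ (R := R) S
    rw [h.card_eq] at hJ
    have hsq := h.sq_eq R
    simp only [Algebra.smul_def, map_add, map_sub, map_mul] at hJ hsq ih ⊢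
    rw [pow_succ, ih]
    linear_combination (algebraMap R (AddMonoidAlgebra R G) β) * hsq +
      (algebraMap R (AddMonoidAlgebra R G) γ) * hJ

lemma exists_mem_notMem_addSubgroup (h : IsRegularPartialDifferenceSet S k l μ) (hμ : 0 < μ)
    {H : AddSubgroup G} (hH : H ≠ ⊤) : ∃ x ∈ S, x ∉ H := by
  by_contra! hS
  refine hH ((AddSubgroup.eq_top_iff' H).2 fun x => ?_)
  by_cases hx : x ∈ S
  · exact hS x hx
  by_cases h0 : x = 0
  · exact h0 ▸ H.zero_mem
  rw [← h.card_of_notMem x hx h0, Finset.card_pos] at hμ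
  obtain ⟨y, hy⟩ := hμ
  rw [Finset.mem_filter] at hy
  simpa using H.add_mem (hS _ hy.2) (hS _ hy.1)

/-- If every neighbour of `0` is a neighbour of a non-neighbour `t` of `0`, then `μ = k`. -/
lemma eq_of_forall_sub_mem (h : IsRegularPartialDifferenceSet S k l μ) {t : G} (ht : t ∉ S)
    (ht0 : t ≠ 0) (hsub : ∀ y ∈ S, t - y ∈ S) : μ = k := by
  rw [← h.card_of_notMem t ht ht0, Finset.filter_true_of_mem hsub, h.card_eq]

lemma exists_notMem_notMem_addSubgroup [Fintype G] (h : IsRegularPartialDifferenceSet S k l μ)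
    (hμ : 0 < μ) (hμk : μ < k) {t : G} (ht : t ∉ S) (ht0 : t ≠ 0) {H : AddSubgroup G}
    (hH : H ≠ ⊤) : ∃ x ∉ S, x ∉ H := by
  by_contra! hS
  have hcard (x : G) (hx : x ∈ S) : #(S ∪ ({y | x - y ∈ S} : Finset G)) + l = 2 * k := by
    have h1 := Finset.card_union_add_card_inter S {y | x - y ∈ S}
    have h2 : S ∩ ({y | x - y ∈ S} : Finset G) = {y ∈ S | x - y ∈ S} := by ext; simp
    have h3 : #({y | x - y ∈ S} : Finset G) = #S :=
      Finset.card_equiv (Equiv.subLeft x) fun y => by simp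
    rw [h2, h.card_of_mem x hx, h3, h.card_eq] at h1
    omega
  obtain ⟨x, hx, hxH⟩ := h.exists_mem_notMem_addSubgroup hμ hH
  have hxu : S ∪ ({y | x - y ∈ S} : Finset G) = univ := by
    refine Finset.eq_univ_of_forall fun y => ?_
    simp only [Finset.mem_union, Finset.mem_filter, Finset.mem_univ, true_and]
    by_contra! hy
    exact hxH (by simpa using H.add_mem (hS _ hy.2) (hS _ hy.1))
  refine hμk.ne (h.eq_of_forall_sub_mem ht ht0 fun y hy => ?_)
  have hyu : S ∪ ({z | y - z ∈ S} : Finset G) = univ := by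
    have h1 := hcard x hx
    have h2 := hcard y hy
    rw [hxu, Finset.card_univ] at h1
    rw [← Finset.card_eq_iff_eq_univ]
    omega
  have := Finset.mem_univ t
  rw [← hyu] at this
  simpa [ht, h.sub_mem_comm] using this

/-- Away from its `p`-torsion, a partial difference set of a cyclic group is a union of cosets of
the `p`-torsion subgroup. -/
lemma mem_of_nsmul_eq_nsmul [Fintype G] [IsAddCyclic G]
    (h : IsRegularPartialDifferenceSet S k l μ)
    (hμ : 0 < μ) (hμk : μ < k) {t : G} (ht : t ∉ S) (ht0 : t ≠ 0) {p : ℕ} (hp : p.Prime)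
    (hpG : p ∣ Fintype.card G) {x y : G} (hx : x ∈ S) (hpx : p • x ≠ 0) (hxy : p • x = p • y) :
    y ∈ S := by
  have : Fact p.Prime := ⟨hp⟩
  obtain ⟨g, hg⟩ := exists_prime_addOrderOf_dvd_card p hpG
  let H : AddSubgroup G := (nsmulAddMonoidHom p : G →+ G).range
  have hH : H ≠ ⊤ := by
    rw [Ne, AddMonoidHom.range_eq_top, ← Finite.injective_iff_surjective]
    intro hinj
    have : g = 0 := hinj (by simp [← hg, addOrderOf_nsmul_eq_zero])
    rw [this, addOrderOf_zero] at hg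
    exact hp.one_lt.ne hg
  obtain ⟨α, β, γ, heq⟩ := h.exists_pow_eq (ZMod p) p
  have hcoeff (z : G) (hz : z ≠ 0) :
      (#{s ∈ S | p • s = z} : ZMod p) = β * (if z ∈ S then 1 else 0) + γ := by
    have := congrArg (fun f => f.coeff z) heq
    simpa [finsetSum_pow_char, coeff_sum_single_one, coeff_add, coeff_smul, coeff_finsetSum,
      one_def, Finsupp.single_apply, Ne.symm hz] using this
  have hempty (z : G) (hz : z ∉ H) : S.filter (fun s => p • s = z) = ∅ :=
    Finset.filter_eq_empty_iff.2 fun s _ hs => hz ⟨s, hs⟩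
  have hγ : γ = 0 := by
    obtain ⟨z, hzS, hz⟩ := h.exists_notMem_notMem_addSubgroup hμ hμk ht ht0 hH
    have := hcoeff z fun h0 => hz (h0 ▸ H.zero_mem)
    simpa [hempty z hz, hzS] using this.symm
  have hβ : β = 0 := by
    obtain ⟨z, hzS, hz⟩ := h.exists_mem_notMem_addSubgroup hμ hH
    have := hcoeff z fun h0 => hz (h0 ▸ H.zero_mem)
    simpa [hempty z hz, hzS, hγ] using this.symm
  have hdvd : p ∣ #{s ∈ S | p • s = p • x} := by
    rw [← CharP.cast_eq_zero_iff (ZMod p), hcoeff _ hpx, hβ, hγ]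
    simp
  have hle : p ≤ #{s ∈ S | p • s = p • x} :=
    Nat.le_of_dvd (Finset.card_pos.2 ⟨x, by simp [hx]⟩) hdvd
  have hcoset : #{s : G | p • s = p • x} ≤ p := by
    refine le_trans (le_of_eq ?_) (IsAddCyclic.card_nsmul_eq_zero_le (α := G) hp.pos)
    exact Finset.card_equiv (Equiv.subRight x) fun s => by simp [smul_sub, sub_eq_zero]
  have hsub : S.filter (fun s => p • s = p • x) = ({s : G | p • s = p • x} : Finset G) :=
    Finset.eq_of_subset_of_card_le (Finset.filter_subset_filter _ (Finset.subset_univ S))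
      (hcoset.trans hle)
  have hy : y ∈ ({s : G | p • s = p • x} : Finset G) := by simp [hxy]
  rw [← hsub] at hy
  exact (Finset.mem_filter.1 hy).1

/-- The closed neighbourhoods of two adjacent vertices do not coincide. -/
lemma false_of_forall_sub_mem (h : IsRegularPartialDifferenceSet S k l μ) (hμ : 0 < μ)
    {t : G} (ht : t ∉ S) (ht0 : t ≠ 0) {x : G} (hx : x ∈ S)
    (hsub : ∀ y ∈ S, y ≠ x → x - y ∈ S) : False := by
  have hfil (z : G) : S.filter (fun y => z - y ∈ S) ⊆ S.erase z := fun y hy => by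
    rw [Finset.mem_filter] at hy
    exact Finset.mem_erase.2 ⟨fun hyz => h.zero_notMem (by simpa [hyz] using hy.2), hy.1⟩
  have hl : l = k - 1 := by
    rw [← h.card_of_mem x hx, ← h.card_eq, ← Finset.card_erase_of_mem hx]
    refine congrArg _ ((hfil x).antisymm fun y hy => ?_)
    rw [Finset.mem_erase] at hy
    exact Finset.mem_filter.2 ⟨hy.2, hsub y hy.2 hy.1⟩
  rw [← h.card_of_notMem t ht ht0, Finset.card_pos] at hμ
  obtain ⟨z, hz⟩ := hμ
  rw [Finset.mem_filter] at hz
  have hzn := h.neg_mem z hz.1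
  have heq := Finset.eq_of_subset_of_card_le (hfil (-z)) (by
    rw [h.card_of_mem _ hzn, hl, Finset.card_erase_of_mem hzn, h.card_eq])
  have hmem : t - z ∈ S.erase (-z) :=
    Finset.mem_erase.2 ⟨fun he => ht0 (by simpa using congrArg (· + z) he), hz.2⟩
  rw [← heq, Finset.mem_filter] at hmem
  have := h.neg_mem _ hmem.2
  simp only [neg_sub, sub_neg_eq_add, sub_add_cancel] at this
  exact ht this

/-- A partial difference set with integral eigenvalues in a cyclic group is a union of orbits on
the elements of prime order. -/
lemma mem_of_addOrderOf_eq [Fintype G] [IsAddCyclic G] (h : IsRegularPartialDifferenceSet S k l μ)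
    (hμ : 0 < μ) (hμk : μ < k) {r : ℤ} (hr : r ^ 2 = ((l : ℤ) - μ) * r + (k - μ))
    {p : ℕ} (hp : p.Prime) {x y : G} (hx : x ∈ S) (hx0 : x ≠ 0) (hpx : p • x = 0)
    (hy0 : y ≠ 0) (hpy : p • y = 0) : y ∈ S := by
  classical
  have : Fact p.Prime := ⟨hp⟩
  have hox : addOrderOf x = p := addOrderOf_eq_prime hpx hx0
  have hmul : y ∈ AddSubgroup.zmultiples x := by
    have hsub : (AddSubgroup.zmultiples x : Set G).toFinset ⊆ ({z | p • z = 0} : Finset G) := by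
      intro z hz
      obtain ⟨j, rfl⟩ := AddSubgroup.mem_zmultiples_iff.1 (Set.mem_toFinset.1 hz)
      simp [smul_comm p j x, hpx]
    have heq := Finset.eq_of_subset_of_card_le hsub (by
      rw [Set.toFinset_card]
      refine (IsAddCyclic.card_nsmul_eq_zero_le (α := G) hp.pos).trans (le_of_eq ?_)
      rw [← hox, ← Nat.card_zmultiples, Nat.card_eq_fintype_card]
      rfl)
    have : y ∈ ({z | p • z = 0} : Finset G) := by simp [hpy]
    rw [← heq] at this
    exact Set.mem_toFinset.1 this
  obtain ⟨j, rfl⟩ := (mem_multiples_iff_mem_zmultiples).2 hmul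
  have hj : ¬ p ∣ j := fun hd => hy0 (by simpa using addOrderOf_dvd_iff_nsmul_eq_zero.1 (hox ▸ hd))
  obtain ⟨q, hqn, hq, hqj⟩ := Nat.forall_exists_prime_gt_and_modEq (2 * k + Nat.card G) hp.ne_zero
    ((Nat.Prime.coprime_iff_not_dvd hp).2 hj).symm
  have hcop : (Nat.card G).Coprime q := by
    refine ((Nat.Prime.coprime_iff_not_dvd hq).2 fun hd => ?_).symm
    have := Nat.le_of_dvd Nat.card_pos hd
    omega
  have := h.nsmul_mem_of_prime hμ hμk hr hq (by omega) hcop hx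
  rwa [nsmul_eq_nsmul_iff_modEq.2 (hox.symm ▸ hqj)] at this

/-- A cyclic group has no nontrivial partial difference set with integral eigenvalues. -/
theorem false_of_isAddCyclic [Fintype G] [IsAddCyclic G]
    (h : IsRegularPartialDifferenceSet S k l μ) (hμ : 0 < μ) (hμk : μ < k) {r : ℤ}
    (hr : r ^ 2 = ((l : ℤ) - μ) * r + (k - μ)) {t : G} (ht : t ∉ S) (ht0 : t ≠ 0) : False := by
  have : Nontrivial G := ⟨t, 0, ht0⟩
  obtain ⟨p, hp, hpG⟩ := Nat.exists_prime_and_dvd (Fintype.one_lt_card (α := G)).ne'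
  have : Fact p.Prime := ⟨hp⟩
  obtain ⟨g, hg⟩ := exists_prime_addOrderOf_dvd_card p hpG
  have hpg : p • g = 0 := hg ▸ addOrderOf_nsmul_eq_zero g
  have hg0 : g ≠ 0 := by
    rintro rfl
    rw [addOrderOf_zero] at hg
    exact hp.one_lt.ne hg
  have hcoset (y : G) (hy : y ∈ S) (hpy : p • y ≠ 0) : g - y ∈ S :=
    h.sub_mem_comm.1 (h.mem_of_nsmul_eq_nsmul hμ hμk ht ht0 hp hpG hy hpy (by simp [smul_sub, hpg]))
  have htors {x y : G} := h.mem_of_addOrderOf_eq (x := x) (y := y) hμ hμk hr hp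
  by_cases hgS : g ∈ S
  · refine h.false_of_forall_sub_mem hμ ht ht0 hgS fun y hy hyg => ?_
    by_cases hpy : p • y = 0
    · exact htors hgS hg0 hpg (sub_ne_zero.2 hyg.symm) (by simp [smul_sub, hpg, hpy])
    · exact hcoset y hy hpy
  · refine hμk.ne (h.eq_of_forall_sub_mem hgS hg0 fun y hy => hcoset y hy fun hpy => hgS ?_)
    exact htors hy (fun h0 => h.zero_notMem (h0 ▸ hy)) hpy hg0 hpg

end IsRegularPartialDifferenceSet

/-- The quotient eigenvalue of a regular clique of a strongly regular graph is an integral root of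
the characteristic equation. -/
lemma SimpleGraph.IsSRGWith.exists_int_eigenvalue {V : Type*} [Fintype V] [DecidableEq V]
    {Γ : SimpleGraph V} [DecidableRel Γ.Adj] {n k l μ a : ℕ} (hΓ : Γ.IsSRGWith n k l μ)
    (htop : Γ ≠ ⊤) (ha : 1 ≤ a) [Nonempty V] {C : Finset V}
    (hC : Γ.IsRegularCliqueWithNexus C a) :
    ∃ r : ℤ, r ^ 2 = ((l : ℤ) - μ) * r + (k - μ) := by
  obtain ⟨hclique, hnexus⟩ := hC
  obtain ⟨u, hu⟩ : ∃ u, u ∈ C := by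
    by_contra! hn
    obtain ⟨v⟩ := ‹Nonempty V›
    have := hnexus v (hn v)
    rw [Finset.filter_eq_empty_iff.2 fun x hx => (hn x hx).elim, Finset.card_empty] at this
    omega
  obtain ⟨w, hw⟩ : ∃ w, w ∉ C := by
    by_contra! hn
    refine htop (top_unique fun x y hxy => hclique (hn x) (hn y) hxy)
  set A := Γ.adjMatrix ℤ
  set χ : V → ℤ := fun v => if v ∈ C then 1 else 0 with hχ
  set r : ℤ := #C - 1 - a with hr
  have hAχ : A *ᵥ χ = r • χ + (a : ℤ) • (1 : V → ℤ) := by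
    ext v
    have hv : (A *ᵥ χ) v = #{u ∈ C | Γ.Adj v u} := by
      rw [adjMatrix_mulVec_apply, Finset.sum_boole]
      congr 2
      ext
      simp [and_comm]
    rw [hv]
    by_cases hvC : v ∈ C
    · have : C.filter (fun u => Γ.Adj v u) = C.erase v := by
        ext z
        simp only [Finset.mem_filter, Finset.mem_erase]
        exact ⟨fun hz => ⟨hz.2.ne', hz.1⟩, fun hz => ⟨hz.2, hclique hvC hz.2 hz.1.symm⟩⟩
      rw [this, Finset.card_erase_of_mem hvC, Nat.cast_pred (Finset.card_pos.2 ⟨v, hvC⟩)]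
      simp [hχ, hvC, hr]
    · simp [hnexus v hvC, hχ, hvC]
  have hA1 : A *ᵥ (1 : V → ℤ) = (k : ℤ) • (1 : V → ℤ) := by
    ext v
    simp [A, adjMatrix_mulVec_apply, hΓ.regular v]
  have hJ : (of 1 : Matrix V V ℤ) *ᵥ χ = (#C : ℤ) • (1 : V → ℤ) := by
    ext v
    simp [mulVec, dotProduct, hχ]
  have hcompl : Γᶜ.adjMatrix ℤ = of 1 - 1 - A := by
    rw [← one_add_adjMatrix_add_compl_adjMatrix_eq_of_one (G := Γ) (α := ℤ),
      ← compl_adjMatrix_eq_adjMatrix_compl]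
    abel
  have hsq : A *ᵥ (A *ᵥ χ) = (k : ℤ) • χ + (l : ℤ) • (A *ᵥ χ) +
      (μ : ℤ) • ((#C : ℤ) • (1 : V → ℤ) - χ - A *ᵥ χ) := by
    rw [mulVec_mulVec, ← sq, hΓ.matrix_eq, hcompl, ← hJ]
    simp only [add_mulVec, smul_mulVec, sub_mulVec, one_mulVec, ← Nat.cast_smul_eq_nsmul ℤ, A]
  rw [hAχ, mulVec_add, mulVec_smul, mulVec_smul, hAχ, hA1] at hsq
  have hin := congrFun hsq u
  have hout := congrFun hsq w
  simp [hχ, hu] at hin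
  simp [hχ, hw] at hout
  exact ⟨r, by linarith⟩

/-- Proposition 3.11: there is no nontrivial strongly regular Neumaier circulant graph. -/
theorem no_srg_neumaier_circulant (n : ℕ) [NeZero n] (S : Finset (ZMod n))
    (Γ : SimpleGraph (ZMod n)) [DecidableRel Γ.Adj] (k l μ a c : ℕ)
    (hSinv : ∀ s ∈ S, -s ∈ S) (hS0 : (0 : ZMod n) ∉ S)
    (hadj : ∀ x y : ZMod n, Γ.Adj x y ↔ x - y ∈ S)
    (hμ : 0 < μ) (hμk : μ < k)
    (hsrg : Γ.IsSRGWith n k l μ) (hneu : Γ.IsNeumaier n k l a c) :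
    False := by
  obtain ⟨-, htop, -, ha, C, -, hC⟩ := hneu
  obtain ⟨r, hr⟩ := hsrg.exists_int_eigenvalue htop ha hC
  have hneg (y : ZMod n) : -y ∈ S ↔ y ∈ S := ⟨fun hy => by simpa using hSinv _ hy, hSinv y⟩
  have hcommon (x : ZMod n) :
      #{y ∈ S | x - y ∈ S} = Fintype.card (Γ.commonNeighbors x 0) := by
    rw [← Set.toFinset_card]
    congr 1
    ext y
    simp [mem_commonNeighbors, hadj, hneg, and_comm]
  have hS : IsRegularPartialDifferenceSet S k l μ :=
    { card_eq := by
        rw [← hsrg.regular 0, ← card_neighborFinset_eq_degree]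
        congr 1
        ext y
        simp [hadj, hneg]
      neg_mem := hSinv
      zero_notMem := hS0
      card_of_mem := fun x hx => by
        rw [hcommon, hsrg.of_adj x 0 ((hadj x 0).2 (by simpa using hx))]
      card_of_notMem := fun x hx hx0 => by
        rw [hcommon, hsrg.of_not_adj hx0 fun hx' => hx (by simpa using (hadj x 0).1 hx')] }
  obtain ⟨x, y, hxy, hnadj⟩ := ne_top_iff_exists_not_adj.1 htop
  exact hS.false_of_isAddCyclic hμ hμk hr (t := x - y) (fun hxS => hnadj ((hadj x y).2 hxS))
    (sub_ne_zero.2 hxy)
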